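/- arXiv:2511.09395 — 2 statements merged into one kernel-verified Lean document; each statement's English description precedes it below -/
import Mathlib

section
/- The only nonzero idempotent of the Vidinli algebra is the unit: if x ∈ ℝ^{2n+1} satisfies x ∗ x = x and x ≠ 0, then x = e₁. -/
noncomputable section

/-- Standard dot product on `ℝ^m`. -/
def dot {m : ℕ} (a b : Fin m → ℝ) : ℝ := ∑ i, a i * b i

/-- The distinguished unit vector `e₁` of the Vidinli algebra (index `0`). -/
def e1 (n : ℕ) : Fin (2*n+1) → ℝ := fun i => if i.val = 0 then 1 else 0

/-- The standard symplectic form `ω` on `ℝ^{2n+1}` (vanishing on `e₁`):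
`ω(a,b) = Σ_{k=1}^n (a_{2k} b_{2k+1} − a_{2k+1} b_{2k})` in the paper's 1-based indexing. -/
def omg (n : ℕ) (a b : Fin (2*n+1) → ℝ) : ℝ :=
  ∑ k : Fin n,
    (a ⟨2*k.val+1, by have := k.isLt; omega⟩ * b ⟨2*k.val+2, by have := k.isLt; omega⟩
   - a ⟨2*k.val+2, by have := k.isLt; omega⟩ * b ⟨2*k.val+1, by have := k.isLt; omega⟩)

/-- The Vidinli multiplication on `ℝ^{2n+1}`. -/
def vprod (n : ℕ) (a b : Fin (2*n+1) → ℝ) : Fin (2*n+1) → ℝ :=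
  dot a (e1 n) • b + dot b (e1 n) • a - dot a b • e1 n + omg n a b • e1 n

theorem dot_e1 {n : ℕ} (a : Fin (2*n+1) → ℝ) : dot a (e1 n) = a 0 := by
  rw [dot, Finset.sum_eq_single 0]
  · simp [e1]
  · intro i _ hi
    simp [e1, hi]
  · simp

theorem omg_self {n : ℕ} (a : Fin (2*n+1) → ℝ) : omg n a a = 0 :=
  Finset.sum_eq_zero fun _ _ => by ring

theorem eq_zero_of_dot_self {m : ℕ} {a : Fin m → ℝ} (h : dot a a = 0) : a = 0 := by
  funext i
  exact mul_self_eq_zero.mp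
    ((Finset.sum_eq_zero_iff_of_nonneg fun j _ => mul_self_nonneg (a j)).mp h i
      (Finset.mem_univ i))

theorem vprod_self_apply {n : ℕ} (a : Fin (2*n+1) → ℝ) (i : Fin (2*n+1)) :
    vprod n a a i = 2 * a 0 * a i - dot a a * e1 n i := by
  simp only [vprod, dot_e1, omg_self, Pi.add_apply, Pi.sub_apply, Pi.smul_apply, smul_eq_mul]
  ring

/-- The only nonzero idempotent of the Vidinli algebra is the unit `e₁`. -/
theorem vidinli_unique_idempotent (n : ℕ) (hn : 1 ≤ n)
    (x : Fin (2*n+1) → ℝ) (hx : vprod n x x = x) (hx0 : x ≠ 0) :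
    x = e1 n := by
  have hc (i : Fin (2*n+1)) : 2 * x 0 * x i - dot x x * e1 n i = x i := by
    rw [← vprod_self_apply, hx]
  have h0 : 2 * x 0 * x 0 - dot x x = x 0 := by simpa [e1] using hc 0
  have ht : 2 * x 0 - 1 ≠ 0 := fun h => hx0 <| eq_zero_of_dot_self <| by
    linear_combination x 0 * h - h0
  have hxi (i : Fin (2*n+1)) (hi : i ≠ 0) : x i = 0 := by
    have h := hc i
    simp only [e1, Fin.val_eq_zero_iff, hi, if_false, mul_zero, sub_zero] at h
    exact (mul_eq_zero.mp (by linear_combination h : (2 * x 0 - 1) * x i = 0)).resolve_left ht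
  have hs : dot x x = x 0 * x 0 :=
    Finset.sum_eq_single 0 (fun i _ hi => by simp [hxi i hi]) (by simp)
  have hx1 : x 0 ≠ 0 := fun h => hx0 <| eq_zero_of_dot_self <| by simp [hs, h]
  have h1 : x 0 = 1 := mul_left_cancel₀ hx1 (by linear_combination h0 + hs)
  funext i
  by_cases hi : i = 0
  · simp [hi, h1, e1]
  · simp [hxi i hi, hi, e1]
end
end

section
/- A linear map D : ℝ^{2n+1} → ℝ^{2n+1} is a derivation of the Vidinli algebra, i.e. D(a ∗ b) = D(a) ∗ b + a ∗ D(b) for all a, b, if and only if D(e₁) = 0, D maps V₀ into V₀, and for all u, v ∈ V₀ one has D(u)·v + u·D(v) = 0 and ω(D(u), v) + ω(u, D(v)) = 0. (That is, the derivation algebra of V_{2n+1} is the unitary Lie algebra 𝔲(n) = 𝔰𝔬(2n) ∩ 𝔰𝔭(2n) acting on V₀.) -/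
noncomputable section

section Bilinear

variable {m : ℕ} (a b c : Fin m → ℝ) (r : ℝ)

lemma dot_comm : dot a b = dot b a := dotProduct_comm a b

lemma dot_add_left : dot (a + b) c = dot a c + dot b c := add_dotProduct a b c

lemma dot_add_right : dot a (b + c) = dot a b + dot a c := dotProduct_add a b c

lemma dot_smul_left : dot (r • a) b = r * dot a b := smul_dotProduct r a b

lemma dot_smul_right : dot a (r • b) = r * dot a b := dotProduct_smul r a b

lemma dot_self_eq_zero : dot a a = 0 ↔ a = 0 := dotProduct_self_eq_zero

end Bilinear

section Vidinli

variable (n : ℕ) (a b c : Fin (2*n+1) → ℝ) (r : ℝ)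

lemma dot_e1_e1 : dot (e1 n) (e1 n) = 1 := by
  simp [dot, e1]

lemma omg_swap : omg n b a = -omg n a b := by
  simp only [omg, ← Finset.sum_neg_distrib]
  exact Finset.sum_congr rfl fun k _ => by ring

lemma omg_add_left : omg n (a + b) c = omg n a c + omg n b c := by
  simp only [omg, ← Finset.sum_add_distrib, Pi.add_apply]
  exact Finset.sum_congr rfl fun k _ => by ring

lemma omg_smul_left : omg n (r • a) b = r * omg n a b := by
  simp only [omg, Finset.mul_sum, Pi.smul_apply, smul_eq_mul]
  exact Finset.sum_congr rfl fun k _ => by ring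

lemma omg_add_right : omg n a (b + c) = omg n a b + omg n a c := by
  rw [omg_swap, omg_add_left, omg_swap n a b, omg_swap n a c]; ring

lemma omg_smul_right : omg n a (r • b) = r * omg n a b := by
  rw [omg_swap, omg_smul_left, omg_swap n a b]; ring

lemma omg_e1_left : omg n (e1 n) a = 0 := by
  simp [omg, e1]

lemma omg_e1_right : omg n a (e1 n) = 0 := by
  rw [omg_swap, omg_e1_left, neg_zero]

lemma vprod_e1_left : vprod n (e1 n) a = a := by
  simp [vprod, dot_e1_e1, omg_e1_left, dot_comm (e1 n) a]

lemma vprod_e1_right : vprod n a (e1 n) = a := by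
  simp [vprod, dot_e1_e1, omg_e1_right]

/-- Every vector splits as a multiple of `e₁` plus a vector of `V₀`. -/
lemma exists_eq_smul_e1_add :
    ∃ (s : ℝ) (u : Fin (2*n+1) → ℝ), dot u (e1 n) = 0 ∧ a = s • e1 n + u := by
  refine ⟨dot a (e1 n), a + (-dot a (e1 n)) • e1 n, ?_, ?_⟩
  · rw [dot_add_left, dot_smul_left, dot_e1_e1]; ring
  · module

variable {n a b}

lemma vprod_of_dot_e1_eq_zero (ha : dot a (e1 n) = 0) (hb : dot b (e1 n) = 0) :
    vprod n a b = (omg n a b - dot a b) • e1 n := by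
  simp only [vprod, ha, hb]; module

end Vidinli

/-- A linear map `D` is a derivation of the Vidinli algebra iff
`D e₁ = 0`, `D` maps `V₀` into `V₀`, and `D|_{V₀}` is skew for both the inner
product and the symplectic form. -/
theorem vidinli_derivation_iff (n : ℕ) (hn : 1 ≤ n)
    (D : (Fin (2*n+1) → ℝ) →ₗ[ℝ] (Fin (2*n+1) → ℝ)) :
    (∀ a b : Fin (2*n+1) → ℝ,
      D (vprod n a b) = vprod n (D a) b + vprod n a (D b)) ↔
    (D (e1 n) = 0 ∧
     (∀ u : Fin (2*n+1) → ℝ, dot u (e1 n) = 0 → dot (D u) (e1 n) = 0) ∧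
     (∀ u v : Fin (2*n+1) → ℝ, dot u (e1 n) = 0 → dot v (e1 n) = 0 →
        dot (D u) v + dot u (D v) = 0 ∧ omg n (D u) v + omg n u (D v) = 0)) := by
  constructor
  · intro h
    have he : D (e1 n) = 0 := by
      simpa [vprod_e1_left, vprod_e1_right] using h (e1 n) (e1 n)
    have hV : ∀ u : Fin (2*n+1) → ℝ, dot u (e1 n) = 0 → dot (D u) (e1 n) = 0 := by
      intro u hu
      have h1 := h u u
      rw [vprod_of_dot_e1_eq_zero hu hu, map_smul, he, smul_zero] at h1
      have h2 := congrArg (fun x => dot x u) h1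
      have hu' : dot (e1 n) u = 0 := by rw [dot_comm, hu]
      have h0 : dot (0 : Fin (2*n+1) → ℝ) u = 0 := by simp [dot]
      simp only [vprod, sub_eq_add_neg, ← neg_smul, dot_add_left, dot_smul_left, hu, hu', h0] at h2
      have h3 : dot (D u) (e1 n) * dot u u = 0 := by linarith
      rcases mul_eq_zero.mp h3 with h4 | h4
      · exact h4
      · rw [(dot_self_eq_zero u).mp h4]; simp [dot]
    have key : ∀ u v : Fin (2*n+1) → ℝ, dot u (e1 n) = 0 → dot v (e1 n) = 0 →
        omg n (D u) v - dot (D u) v + (omg n u (D v) - dot u (D v)) = 0 := by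
      intro u v hu hv
      have h1 := h u v
      rw [vprod_of_dot_e1_eq_zero hu hv, map_smul, he, smul_zero,
        vprod_of_dot_e1_eq_zero (hV u hu) hv, vprod_of_dot_e1_eq_zero hu (hV v hv),
        ← add_smul] at h1
      simpa [e1] using (congrFun h1 0).symm
    refine ⟨he, hV, fun u v hu hv => ?_⟩
    have h1 := key u v hu hv
    have h2 := key v u hv hu
    rw [omg_swap n u (D v), omg_swap n (D u) v, dot_comm (D v) u, dot_comm v (D u)] at h2
    constructor <;> linarith
  · rintro ⟨he, hV, hS⟩ a b
    obtain ⟨s, u, hu, rfl⟩ := exists_eq_smul_e1_add n a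
    obtain ⟨t, v, hv, rfl⟩ := exists_eq_smul_e1_add n b
    obtain ⟨h1, h2⟩ := hS u v hu hv
    have hv' : dot (e1 n) (D v) = 0 := by rw [dot_comm, hV v hv]
    have h3 : dot u (D v) = -dot (D u) v := by linarith
    have h4 : omg n u (D v) = -omg n (D u) v := by linarith
    simp only [vprod, map_add, map_sub, map_smul, he, smul_zero, zero_add, dot_add_left,
      dot_add_right, dot_smul_left, dot_smul_right, omg_add_left, omg_add_right, omg_smul_left,
      omg_smul_right, omg_e1_left, omg_e1_right, dot_e1_e1, hu, hv, hv', hV u hu, hV v hv,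
      h3, h4]
    module
end
end
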